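/- arXiv:1609.09686 — 6 statements merged into one kernel-verified Lean document; each statement's English description precedes it below -/
import Mathlib

section
/- Let L be a finite lattice and let μ denote its Möbius function. Then for any elements π, τ, σ ∈ L with π < τ ≤ σ, the sum of μ(π, ω) over all ω ∈ L satisfying π ≤ ω ≤ σ and ω ⊔ τ = σ equals 0. -/
/-- The Möbius function of a finite partially ordered set: `μ(x,x) = 1`,
`μ(x,y) = −Σ_{x ≤ z < y} μ(x,z)` for `x < y`, and `μ(x,y) = 0` if `x ≰ y`. -/
def mobius {L : Type*} [Lattice L] [Fintype L] [DecidableEq L]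
    [DecidableRel ((· ≤ ·) : L → L → Prop)] (x : L) (y : L) : ℤ :=
  if x = y then 1
  else if x ≤ y then
    - ∑ z ∈ (Finset.univ.filter (fun z : L => x ≤ z ∧ z ≤ y ∧ z ≠ y)).attach,
        mobius x z.1
  else 0
termination_by (Finset.univ.filter (fun w : L => w ≤ y ∧ w ≠ y)).card
decreasing_by
  have hz := (Finset.mem_filter.mp z.2).2
  obtain ⟨hxz, hzy, hzney⟩ := hz
  apply Finset.card_lt_card
  rw [Finset.ssubset_iff_of_subset]
  · exact ⟨z.1, Finset.mem_filter.mpr ⟨Finset.mem_univ _, hzy, hzney⟩,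
      fun hmem => (Finset.mem_filter.mp hmem).2.2 rfl⟩
  · intro w hw
    have hw' := (Finset.mem_filter.mp hw).2
    refine Finset.mem_filter.mpr ⟨Finset.mem_univ _, le_trans hw'.1 hzy, fun hwy => ?_⟩
    subst hwy
    exact hzney (le_antisymm hzy hw'.1)

/-- Over a nontrivial interval, the values of the Möbius function sum to zero. -/
theorem sum_mobius_of_lt {L : Type*} [Lattice L] [Fintype L] [DecidableEq L]
    [DecidableRel ((· ≤ ·) : L → L → Prop)] {x y : L} (hxy : x < y) :
    ∑ z ∈ Finset.univ.filter (fun z : L => x ≤ z ∧ z ≤ y), mobius x z = 0 := by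
  have hy : mobius x y =
      - ∑ z ∈ Finset.univ.filter (fun z : L => x ≤ z ∧ z ≤ y ∧ z ≠ y), mobius x z := by
    rw [mobius, if_neg hxy.ne, if_pos hxy.le, Finset.sum_attach _ (mobius x)]
  have hins : Finset.univ.filter (fun z : L => x ≤ z ∧ z ≤ y) =
      insert y (Finset.univ.filter (fun z : L => x ≤ z ∧ z ≤ y ∧ z ≠ y)) := by
    ext z
    have := hxy.le
    by_cases hz : z = y <;> simp_all
  rw [hins, Finset.sum_insert (by simp), hy, neg_add_cancel]

/-- Weisner's theorem: in a finite lattice `L`, for `π < τ ≤ σ`,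
`Σ_{π ≤ ω ≤ σ, ω ⊔ τ = σ} μ(π, ω) = 0`. -/
theorem weisner {L : Type*} [Lattice L] [Fintype L] [DecidableEq L]
    [DecidableRel ((· ≤ ·) : L → L → Prop)]
    (π τ σ : L) (hπτ : π < τ) (hτσ : τ ≤ σ) :
    ∑ ω ∈ Finset.univ.filter (fun ω : L => π ≤ ω ∧ ω ≤ σ ∧ ω ⊔ τ = σ),
      mobius π ω = 0 := by
  induction σ using WellFoundedLT.induction with
  | ind σ ih =>
  have hmaps : ∀ ω ∈ Finset.univ.filter (fun ω : L => π ≤ ω ∧ ω ≤ σ),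
      ω ⊔ τ ∈ Finset.univ.filter (fun ρ : L => τ ≤ ρ ∧ ρ ≤ σ) := by
    simp_all
  have hfib := Finset.sum_fiberwise_of_maps_to hmaps (mobius π)
  rw [sum_mobius_of_lt (hπτ.trans_le hτσ),
    Finset.sum_eq_single_of_mem σ (by simpa using hτσ), Finset.filter_filter] at hfib
  · simpa only [and_assoc] using hfib
  · intro ρ hρ hne
    obtain ⟨hτρ, hρσ⟩ := (Finset.mem_filter.mp hρ).2
    rw [← ih ρ (lt_of_le_of_ne hρσ hne) hτρ, Finset.filter_filter]
    congr 1
    ext ω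
    simp only [Finset.mem_filter, Finset.mem_univ, true_and]
    constructor
    · rintro ⟨⟨h₁, _⟩, h₂⟩
      exact ⟨h₁, le_sup_left.trans_eq h₂, h₂⟩
    · rintro ⟨h₁, h₂, h₃⟩
      exact ⟨⟨h₁, h₂.trans hρσ⟩, h₃⟩
end

section
/- Let K be a commutative ring, D : K → K a derivation (an additive map satisfying D(fg) = (Df)·g + f·(Dg)), and let r, k be positive integers. Let u be a family assigning to each subset I of {1,…,r} an element u_I ∈ K. For a set partition π of {1,…,r} define D̃^k(u_B : B ∈ π) := Σ_{B∈π} (D^k u_B) · ∏_{B'∈π, B'≠B} u_{B'}, and define D̃^k κ_{[r]}(u) := Σ_{π ∈ P([r])} (−1)^{#π−1}(#π−1)! · D̃^k(u_B : B ∈ π), where P([r]) is the set of all set partitions of {1,…,r}. Then D̃^k κ_{[r]}(u) = Σ_{π ∈ P([r]), #π ≤ k} Σ_{α} (k!/∏_{B∈π} α(B)!) · ∏_{B∈π} D^{α(B)} κ_B(u), where the inner sum runs over all functions α : π → {1,2,3,…} with positive integer values satisfying Σ_{B∈π} α(B) = k. -/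
/-- The set of all set partitions of a finite set `s` into nonempty blocks, encoded as
finsets of pairwise disjoint nonempty finsets whose union is `s`. -/
def partitionsOf {α : Type*} [DecidableEq α] (s : Finset α) : Finset (Finset (Finset α)) :=
  s.powerset.powerset.filter
    (fun π => (∀ B ∈ π, B ≠ ∅) ∧ (∀ B ∈ π, ∀ B' ∈ π, B ≠ B' → B ∩ B' = ∅) ∧
      π.sup id = s)

/-- The partial cumulant `κ_H(u) = Σ_{π ∈ P(H)} (−1)^{#π−1}(#π−1)! ∏_{B∈π} u_B`. -/
def cumulant {α K : Type*} [DecidableEq α] [CommRing K] (u : Finset α → K)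
    (H : Finset α) : K :=
  ∑ π ∈ partitionsOf H,
    ((-1 : ℤ) ^ (π.card - 1) * (π.card - 1).factorial) • ∏ B ∈ π, u B

section SetPartition

variable {α : Type*} [DecidableEq α]

theorem mem_partitionsOf {s : Finset α} {π : Finset (Finset α)} :
    π ∈ partitionsOf s ↔ (∀ B ∈ π, B ≠ ∅) ∧
      (∀ B ∈ π, ∀ B' ∈ π, B ≠ B' → B ∩ B' = ∅) ∧ π.sup id = s := by
  simp only [partitionsOf, Finset.mem_filter, Finset.mem_powerset, and_iff_right_iff_imp]
  rintro ⟨-, -, rfl⟩ B hB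
  exact Finset.mem_powerset.2 (Finset.le_sup (f := id) hB)

theorem partitionsOf_empty : partitionsOf (∅ : Finset α) = {∅} := by
  ext π
  simp only [mem_partitionsOf, Finset.mem_singleton]
  constructor
  · rintro ⟨h, -, hs⟩
    refine Finset.eq_empty_of_forall_notMem fun B hB => h B hB ?_
    exact Finset.subset_empty.1 (hs ▸ Finset.le_sup (f := id) hB)
  · rintro rfl
    simp

theorem subset_of_mem_partitionsOf {s B : Finset α} {π : Finset (Finset α)}
    (hπ : π ∈ partitionsOf s) (hB : B ∈ π) : B ⊆ s :=
  (mem_partitionsOf.1 hπ).2.2 ▸ Finset.le_sup (f := id) hB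

theorem notMem_of_mem_partitionsOf_sdiff {s B : Finset α} {σ : Finset (Finset α)}
    (hσ : σ ∈ partitionsOf (s \ B)) (hB : B ≠ ∅) : B ∉ σ := by
  intro h
  obtain ⟨x, hx⟩ := Finset.nonempty_iff_ne_empty.2 hB
  exact (Finset.mem_sdiff.1 (subset_of_mem_partitionsOf hσ h hx)).2 hx

theorem erase_mem_partitionsOf {s B : Finset α} {π : Finset (Finset α)}
    (hπ : π ∈ partitionsOf s) (hB : B ∈ π) : π.erase B ∈ partitionsOf (s \ B) := by
  obtain ⟨hne, hdisj, rfl⟩ := mem_partitionsOf.1 hπ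
  refine mem_partitionsOf.2 ⟨fun C hC => hne C (Finset.mem_of_mem_erase hC),
    fun C hC C' hC' => hdisj C (Finset.mem_of_mem_erase hC) C' (Finset.mem_of_mem_erase hC'), ?_⟩
  ext x
  simp only [Finset.mem_sup, Finset.mem_erase, id, Finset.mem_sdiff]
  constructor
  · rintro ⟨C, ⟨hCB, hC⟩, hx⟩
    refine ⟨⟨C, hC, hx⟩, fun hxB => ?_⟩
    have := hdisj C hC B hB hCB
    exact Finset.notMem_empty x (this ▸ Finset.mem_inter.2 ⟨hx, hxB⟩)
  · rintro ⟨⟨C, hC, hx⟩, hxB⟩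
    exact ⟨C, ⟨fun h => hxB (h ▸ hx), hC⟩, hx⟩

theorem insert_mem_partitionsOf {s B : Finset α} {σ : Finset (Finset α)}
    (hσ : σ ∈ partitionsOf (s \ B)) (hB : B ≠ ∅) (hBs : B ⊆ s) :
    insert B σ ∈ partitionsOf s := by
  have hsub : ∀ C ∈ σ, B ∩ C = ∅ := fun C hC => by
    refine Finset.disjoint_iff_inter_eq_empty.1 (Finset.disjoint_left.2 fun x hxB hxC => ?_)
    exact (Finset.mem_sdiff.1 (subset_of_mem_partitionsOf hσ hC hxC)).2 hxB
  obtain ⟨hne, hdisj, hs⟩ := mem_partitionsOf.1 hσ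
  refine mem_partitionsOf.2 ⟨?_, ?_, ?_⟩
  · simpa [hB] using hne
  · intro C hC C' hC' h
    rcases Finset.mem_insert.1 hC with rfl | hC₁ <;>
      rcases Finset.mem_insert.1 hC' with rfl | hC₁'
    · exact absurd rfl h
    · exact hsub _ hC₁'
    · rw [Finset.inter_comm]
      exact hsub _ hC₁
    · exact hdisj C hC₁ C' hC₁' h
  · rw [Finset.sup_insert, hs]
    exact Finset.union_sdiff_of_subset hBs

/-- Summing over set partitions with a marked block amounts to choosing the marked block and
a set partition of its complement. -/
theorem sum_partitionsOf_sum_block {M : Type*} [AddCommMonoid M] (s : Finset α)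
    (F : Finset α → Finset (Finset α) → M) :
    ∑ π ∈ partitionsOf s, ∑ B ∈ π, F B (π.erase B) =
      ∑ B ∈ s.powerset, if B = ∅ then 0 else ∑ σ ∈ partitionsOf (s \ B), F B σ := by
  have h : ∀ B ∈ s.powerset, (if B = ∅ then 0 else ∑ σ ∈ partitionsOf (s \ B), F B σ) =
      ∑ σ ∈ if B = ∅ then ∅ else partitionsOf (s \ B), F B σ := by
    intro B _
    split_ifs <;> simp
  rw [Finset.sum_congr rfl h, Finset.sum_sigma', Finset.sum_sigma']
  refine Finset.sum_bij' (fun x _ => ⟨x.2, x.1.erase x.2⟩) (fun x _ => ⟨insert x.1 x.2, x.1⟩)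
    ?_ ?_ ?_ ?_ ?_
  · rintro ⟨π, B⟩ hx
    obtain ⟨hπ, hB⟩ := Finset.mem_sigma.1 hx
    have hB0 := (mem_partitionsOf.1 hπ).1 B hB
    simp only [Finset.mem_sigma, Finset.mem_powerset, if_neg hB0]
    exact ⟨subset_of_mem_partitionsOf hπ hB, erase_mem_partitionsOf hπ hB⟩
  · rintro ⟨B, σ⟩ hx
    obtain ⟨hB, hσ⟩ := Finset.mem_sigma.1 hx
    by_cases hB0 : B = ∅
    · simp [hB0] at hσ
    · simp only [if_neg hB0] at hσ
      simp only [Finset.mem_sigma, Finset.mem_insert_self, and_true]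
      exact insert_mem_partitionsOf hσ hB0 (Finset.mem_powerset.1 hB)
  · rintro ⟨π, B⟩ hx
    obtain ⟨hπ, hB⟩ := Finset.mem_sigma.1 hx
    simp only [Finset.insert_erase hB]
  · rintro ⟨B, σ⟩ hx
    obtain ⟨hB, hσ⟩ := Finset.mem_sigma.1 hx
    by_cases hB0 : B = ∅
    · simp [hB0] at hσ
    · simp only [if_neg hB0] at hσ
      simp only [Finset.erase_insert (notMem_of_mem_partitionsOf_sdiff hσ hB0)]
  · rintro ⟨π, B⟩ _
    rfl

/-- A sum over set partitions of `s`, organised by the block containing a given element. -/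
theorem sum_partitionsOf_of_mem {M : Type*} [AddCommMonoid M] {s : Finset α} {a : α}
    (ha : a ∈ s) (F : Finset (Finset α) → M) :
    ∑ π ∈ partitionsOf s, F π =
      ∑ B ∈ s.powerset, if a ∈ B then ∑ σ ∈ partitionsOf (s \ B), F (insert B σ) else 0 := by
  have h : ∀ π ∈ partitionsOf s,
      F π = ∑ B ∈ π, if a ∈ B then F (insert B (π.erase B)) else 0 := by
    intro π hπ
    obtain ⟨-, hdisj, hs⟩ := mem_partitionsOf.1 hπ
    obtain ⟨B, hB, haB⟩ := Finset.mem_sup.1 (hs.symm ▸ ha)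
    replace haB : a ∈ B := haB
    rw [Finset.sum_eq_single_of_mem B hB, if_pos haB, Finset.insert_erase hB]
    intro C hC hCB
    refine if_neg fun haC => ?_
    exact Finset.notMem_empty a (hdisj C hC B hB hCB ▸ Finset.mem_inter.2 ⟨haC, haB⟩)
  rw [Finset.sum_congr rfl h,
    sum_partitionsOf_sum_block s fun B σ => if a ∈ B then F (insert B σ) else 0]
  refine Finset.sum_congr rfl fun B _ => ?_
  by_cases haB : a ∈ B
  · rw [if_neg (Finset.ne_empty_of_mem haB)]
    simp [haB]
  · simp [haB]

end SetPartition

section SubsetConvolution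

variable {α K : Type*} [DecidableEq α] [CommRing K]

/-- The subset convolution of two set functions. -/
def subsetConv (f g : Finset α → K) (s : Finset α) : K :=
  ∑ A ∈ s.powerset, f A * g (s \ A)

/-- The restriction of a set function to the sets containing `a`. -/
def restrictMem (a : α) (f : Finset α → K) (s : Finset α) : K :=
  if a ∈ s then f s else 0

/-- The neutral element of subset convolution. -/
def subsetOne (s : Finset α) : K := if s = ∅ then 1 else 0

theorem subsetConv_comm (f g : Finset α → K) : subsetConv f g = subsetConv g f := by
  ext s
  refine Finset.sum_bij' (fun A _ => s \ A) (fun A _ => s \ A) ?_ ?_ ?_ ?_ ?_ <;>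
    simp only [Finset.mem_powerset] <;> intro A hA
  · exact Finset.sdiff_subset
  · exact Finset.sdiff_subset
  · exact Finset.sdiff_sdiff_eq_self hA
  · exact Finset.sdiff_sdiff_eq_self hA
  · rw [Finset.sdiff_sdiff_eq_self hA, mul_comm]

theorem subsetConv_assoc (f g h : Finset α → K) :
    subsetConv (subsetConv f g) h = subsetConv f (subsetConv g h) := by
  ext s
  simp only [subsetConv, Finset.sum_mul, Finset.mul_sum]
  rw [Finset.sum_sigma', Finset.sum_sigma']
  refine Finset.sum_bij' (fun x _ => ⟨x.2, x.1 \ x.2⟩) (fun x _ => ⟨x.1 ∪ x.2, x.1⟩)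
    ?_ ?_ ?_ ?_ ?_
  · rintro ⟨C, A⟩ hx
    simp only [Finset.mem_sigma, Finset.mem_powerset] at hx ⊢
    exact ⟨hx.2.trans hx.1, Finset.sdiff_subset_sdiff hx.1 subset_rfl⟩
  · rintro ⟨A, B⟩ hx
    simp only [Finset.mem_sigma, Finset.mem_powerset] at hx ⊢
    exact ⟨Finset.union_subset hx.1 (hx.2.trans Finset.sdiff_subset), Finset.subset_union_left⟩
  · rintro ⟨C, A⟩ hx
    simp only [Finset.mem_sigma, Finset.mem_powerset] at hx
    simp only [Finset.union_sdiff_of_subset hx.2]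
  · rintro ⟨A, B⟩ hx
    simp only [Finset.mem_sigma, Finset.mem_powerset] at hx
    have : (A ∪ B) \ A = B :=
      Finset.union_sdiff_cancel_left (Finset.disjoint_of_subset_right hx.2 Finset.disjoint_sdiff)
    simp only [this]
  · rintro ⟨C, A⟩ hx
    simp only [Finset.mem_sigma, Finset.mem_powerset] at hx
    have : (s \ A) \ (C \ A) = s \ C := by
      ext x
      have := @hx.2 x
      simp only [Finset.mem_sdiff]
      tauto
    simp only [this, mul_assoc]

theorem subsetConv_one (f : Finset α → K) : subsetConv f subsetOne = f := by
  ext s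
  rw [subsetConv, Finset.sum_eq_single_of_mem s (Finset.mem_powerset_self s)]
  · simp [subsetOne]
  · intro A hA hAs
    have : s \ A ≠ ∅ := fun h =>
      hAs ((Finset.mem_powerset.1 hA).antisymm (Finset.sdiff_eq_empty_iff_subset.1 h))
    simp [subsetOne, this]

theorem restrictMem_subsetConv (a : α) (f g : Finset α → K) (s : Finset α) :
    restrictMem a (subsetConv f g) s =
      subsetConv (restrictMem a f) g s + subsetConv f (restrictMem a g) s := by
  simp only [restrictMem, subsetConv, ← Finset.sum_add_distrib]
  by_cases ha : a ∈ s
  · rw [if_pos ha]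
    refine Finset.sum_congr rfl fun A _ => ?_
    by_cases haA : a ∈ A <;> simp [ha, haA]
  · rw [if_neg ha]
    refine (Finset.sum_eq_zero fun A hA => ?_).symm
    have haA : a ∉ A := fun h => ha (Finset.mem_powerset.1 hA h)
    simp [ha, haA]

/-- Only proper subsets enter the second factor of a convolution with `restrictMem a f`. -/
theorem subsetConv_restrictMem_congr (a : α) (f : Finset α → K) {g h : Finset α → K}
    {s : Finset α} (hgh : ∀ t ⊂ s, g t = h t) :
    subsetConv (restrictMem a f) g s = subsetConv (restrictMem a f) h s := by
  refine Finset.sum_congr rfl fun A hA => ?_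
  by_cases haA : a ∈ A
  · rw [hgh _ (Finset.sdiff_ssubset (Finset.mem_powerset.1 hA) ⟨a, haA⟩)]
  · simp [restrictMem, haA]

end SubsetConvolution

section Multinomial

variable {ι K : Type*} [DecidableEq ι] [CommRing K]

/-- The sum of `k! / ∏ α(i)! • ∏ d (α i) i` over all `α : s → ℕ` with sum `k`. -/
def multinomialSum (d : ℕ → ι → K) (s : Finset ι) (k : ℕ) : K :=
  ∑ α ∈ s.piAntidiag k, Nat.multinomial s α • ∏ i ∈ s, d (α i) i

theorem multinomialSum_empty (d : ℕ → ι → K) (k : ℕ) :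
    multinomialSum d ∅ k = if k = 0 then 1 else 0 := by
  rw [multinomialSum, Finset.piAntidiag_empty]
  split_ifs <;> simp

theorem multinomialSum_insert (d : ℕ → ι → K) {s : Finset ι} {b : ι} (hb : b ∉ s) (k : ℕ) :
    multinomialSum d (insert b s) k =
      ∑ ij ∈ Finset.HasAntidiagonal.antidiagonal k, k.choose ij.1 • (d ij.1 b * multinomialSum d s ij.2) := by
  rw [multinomialSum, ← Finset.cons_eq_insert b s hb, Finset.piAntidiag_cons,
    Finset.sum_disjiUnion]
  refine Finset.sum_congr rfl fun ij hij => ?_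
  rw [Finset.sum_map, multinomialSum, Finset.mul_sum, Finset.smul_sum]
  refine Finset.sum_congr rfl fun β hβ => ?_
  obtain ⟨hsum, hsupp⟩ := Finset.mem_piAntidiag.1 hβ
  have hβb : β b = 0 := by
    by_contra h
    exact hb (hsupp b h)
  set γ : ι → ℕ := addRightEmbedding (fun t => if t = b then ij.1 else 0) β with hγ
  have hγb : γ b = ij.1 := by simp [hγ, hβb]
  have hγs : ∀ i ∈ s, γ i = β i := fun i hi => by
    have : i ≠ b := fun h => hb (h ▸ hi)
    simp [hγ, this]
  rw [Nat.multinomial_cons hb, Finset.prod_cons, hγb, Nat.multinomial_congr hγs,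
    Finset.sum_congr rfl hγs, hsum, Finset.HasAntidiagonal.mem_antidiagonal.1 hij,
    Finset.prod_congr rfl fun i hi => by rw [hγs i hi], mul_smul_comm, mul_smul]

end Multinomial

section Derivation

variable {K : Type*} [CommRing K] {D : K → K}

theorem iterate_map_sum_of_add (hadd : ∀ f g : K, D (f + g) = D f + D g) {ι : Type*}
    (s : Finset ι) (f : ι → K) (k : ℕ) : D^[k] (∑ i ∈ s, f i) = ∑ i ∈ s, D^[k] (f i) := by
  induction k generalizing f with
  | zero => rfl
  | succ k ih =>
    simp only [Function.iterate_succ_apply]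
    rw [← ih]
    exact congrArg _ (map_sum (AddMonoidHom.mk' D hadd) f s)

theorem iterate_leibniz_of_add (hadd : ∀ f g : K, D (f + g) = D f + D g)
    (hleib : ∀ f g : K, D (f * g) = D f * g + f * D g) (f g : K) (k : ℕ) :
    D^[k] (f * g) =
      ∑ ij ∈ Finset.HasAntidiagonal.antidiagonal k, k.choose ij.1 • (D^[ij.1] f * D^[ij.2] g) := by
  have hnsmul : ∀ (n : ℕ) (x : K), D (n • x) = n • D x := fun n x =>
    map_nsmul (AddMonoidHom.mk' D hadd) n x
  induction k with
  | zero => simp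
  | succ k ih =>
    rw [Finset.sum_antidiagonal_choose_succ_nsmul (fun i j => D^[i] f * D^[j] g) k,
      Function.iterate_succ_apply', ih]
    have hs := iterate_map_sum_of_add hadd (Finset.HasAntidiagonal.antidiagonal k)
      (fun ij => k.choose ij.1 • (D^[ij.1] f * D^[ij.2] g)) 1
    simp only [Function.iterate_one] at hs
    rw [hs]
    simp only [hnsmul, hleib, smul_add, Finset.sum_add_distrib, Function.iterate_succ_apply']
    rw [add_comm]
    congr 1
    refine Finset.sum_congr rfl fun ij hij => ?_
    rw [Nat.choose_symm_of_eq_add (Finset.HasAntidiagonal.mem_antidiagonal.1 hij).symm]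

theorem iterate_one_of_leibniz (hadd : ∀ f g : K, D (f + g) = D f + D g)
    (hleib : ∀ f g : K, D (f * g) = D f * g + f * D g) (k : ℕ) :
    D^[k] (1 : K) = if k = 0 then 1 else 0 := by
  have h1 : D 1 = 0 := by simpa using hleib 1 1
  have h0 : D 0 = 0 := by simpa using hadd 0 0
  cases k with
  | zero => simp
  | succ k => rw [Function.iterate_succ_apply, h1, Function.iterate_fixed h0]; simp

end Derivation

section Cumulant

variable {α K : Type*} [DecidableEq α] [CommRing K]

/-- The family `u`, normalised to take the value `1` at the empty set. -/
def unitalFamily (u : Finset α → K) (s : Finset α) : K := if s = ∅ then 1 else u s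

/-- The inverse of `unitalFamily u` for subset convolution. -/
def inverseFamily (u : Finset α → K) (s : Finset α) : K :=
  ∑ π ∈ partitionsOf s, ((-1 : ℤ) ^ π.card * π.card.factorial) • ∏ B ∈ π, u B

theorem card_erase_mul_prod (u v : Finset α → K) {π : Finset (Finset α)} {B : Finset α}
    (hB : B ∈ π) :
    ((-1 : ℤ) ^ (π.card - 1) * (π.card - 1).factorial) • (v B * ∏ C ∈ π.erase B, u C) =
      v B * (((-1 : ℤ) ^ (π.erase B).card * (π.erase B).card.factorial) •
        ∏ C ∈ π.erase B, u C) := by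
  rw [Finset.card_erase_of_mem hB, mul_smul_comm]

/-- Marking a block of each partition and weighting it by `v` gives `v * u⁻¹`. -/
theorem sum_partitionsOf_marked (u v : Finset α → K) (s : Finset α) :
    ∑ π ∈ partitionsOf s, ((-1 : ℤ) ^ (π.card - 1) * (π.card - 1).factorial) •
        (∑ B ∈ π, v B * ∏ C ∈ π.erase B, u C) =
      subsetConv (fun B => if B = ∅ then 0 else v B) (inverseFamily u) s := by
  have h : ∀ π ∈ partitionsOf s, ((-1 : ℤ) ^ (π.card - 1) * (π.card - 1).factorial) •
        (∑ B ∈ π, v B * ∏ C ∈ π.erase B, u C) =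
      ∑ B ∈ π, v B * (((-1 : ℤ) ^ (π.erase B).card * (π.erase B).card.factorial) •
        ∏ C ∈ π.erase B, u C) := fun π _ => by
    rw [Finset.smul_sum]
    exact Finset.sum_congr rfl fun B hB => card_erase_mul_prod u v hB
  rw [Finset.sum_congr rfl h, sum_partitionsOf_sum_block s fun B σ =>
    v B * (((-1 : ℤ) ^ σ.card * σ.card.factorial) • ∏ C ∈ σ, u C)]
  refine Finset.sum_congr rfl fun B _ => ?_
  by_cases hB : B = ∅
  · simp [hB]
  · simp only [if_neg hB, inverseFamily, Finset.mul_sum]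

theorem subsetConv_unitalFamily_inverseFamily (u : Finset α → K) :
    subsetConv (unitalFamily u) (inverseFamily u) = subsetOne := by
  ext s
  have hsplit : subsetConv (unitalFamily u) (inverseFamily u) s = inverseFamily u s +
      subsetConv (fun B => if B = ∅ then 0 else u B) (inverseFamily u) s := by
    rw [← congrFun (subsetConv_one (inverseFamily u)) s,
      subsetConv_comm (inverseFamily u) subsetOne]
    simp only [subsetConv, ← Finset.sum_add_distrib, ← add_mul]
    refine Finset.sum_congr rfl fun B _ => ?_
    by_cases hB : B = ∅ <;> simp [hB, unitalFamily, subsetOne]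
  rw [hsplit, ← sum_partitionsOf_marked, inverseFamily]
  by_cases hs : s = ∅
  · subst hs
    simp [partitionsOf_empty, subsetOne]
  · rw [← Finset.sum_add_distrib, subsetOne, if_neg hs]
    refine Finset.sum_eq_zero fun π hπ => ?_
    have hne : π.Nonempty := by
      rw [Finset.nonempty_iff_ne_empty]
      rintro rfl
      exact hs (by simpa using (mem_partitionsOf.1 hπ).2.2.symm)
    obtain ⟨n, hn⟩ := Nat.exists_eq_succ_of_ne_zero hne.card_pos.ne'
    rw [Finset.sum_congr rfl fun B hB => Finset.mul_prod_erase π u hB, Finset.sum_const, hn,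
      ← natCast_zsmul, ← mul_smul, ← add_smul]
    have : (-1 : ℤ) ^ n.succ * (n.succ.factorial : ℤ) +
        (-1 : ℤ) ^ (n.succ - 1) * ((n.succ - 1).factorial : ℤ) * (n.succ : ℤ) = 0 := by
      rw [Nat.succ_sub_one, Nat.factorial_succ, pow_succ]
      push_cast
      ring
    rw [this, zero_smul]

theorem restrictMem_cumulant (a : α) (u : Finset α → K) :
    restrictMem a (cumulant u) =
      subsetConv (restrictMem a (unitalFamily u)) (inverseFamily u) := by
  ext s
  by_cases ha : a ∈ s
  · rw [restrictMem, if_pos ha, cumulant, sum_partitionsOf_of_mem ha]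
    refine Finset.sum_congr rfl fun B _ => ?_
    by_cases haB : a ∈ B
    · have hB := Finset.ne_empty_of_mem haB
      rw [if_pos haB, restrictMem, if_pos haB, unitalFamily, if_neg hB, inverseFamily,
        Finset.mul_sum]
      refine Finset.sum_congr rfl fun σ hσ => ?_
      have hBσ := notMem_of_mem_partitionsOf_sdiff hσ hB
      rw [Finset.card_insert_of_notMem hBσ, Finset.prod_insert hBσ, Nat.add_sub_cancel,
        mul_smul_comm]
    · simp [restrictMem, haB]
  · rw [restrictMem, if_neg ha]
    refine (Finset.sum_eq_zero fun A hA => ?_).symm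
    have haA : a ∉ A := fun h => ha (Finset.mem_powerset.1 hA h)
    simp [restrictMem, haA]

/-- The moment-cumulant relation, in recursive form. -/
theorem subsetConv_restrictMem_cumulant (a : α) (u : Finset α → K) :
    subsetConv (restrictMem a (cumulant u)) (unitalFamily u) =
      restrictMem a (unitalFamily u) := by
  rw [restrictMem_cumulant, subsetConv_assoc, subsetConv_comm (inverseFamily u),
    subsetConv_unitalFamily_inverseFamily, subsetConv_one]

/-- The sum over set partitions of `s` of the multinomial sums of `d`. -/
def partitionMultinomialSum (d : ℕ → Finset α → K) (k : ℕ) (s : Finset α) : K :=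
  ∑ π ∈ partitionsOf s, multinomialSum d π k

theorem partitionMultinomialSum_of_mem (d : ℕ → Finset α → K) (k : ℕ) {s : Finset α} {a : α}
    (ha : a ∈ s) :
    partitionMultinomialSum d k s =
      ∑ ij ∈ Finset.HasAntidiagonal.antidiagonal k, k.choose ij.1 •
        subsetConv (restrictMem a (d ij.1)) (partitionMultinomialSum d ij.2) s := by
  simp only [subsetConv, Finset.smul_sum]
  rw [partitionMultinomialSum, sum_partitionsOf_of_mem ha, Finset.sum_comm]
  refine Finset.sum_congr rfl fun B _ => ?_
  by_cases haB : a ∈ B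
  · simp only [restrictMem, if_pos haB, partitionMultinomialSum, Finset.mul_sum, Finset.smul_sum]
    rw [Finset.sum_comm]
    refine Finset.sum_congr rfl fun σ hσ => ?_
    exact multinomialSum_insert d
      (notMem_of_mem_partitionsOf_sdiff hσ (Finset.ne_empty_of_mem haB)) k
  · simp [restrictMem, haB]

theorem restrictMem_partitionMultinomialSum (d : ℕ → Finset α → K) (k : ℕ) (a : α) :
    restrictMem a (partitionMultinomialSum d k) = fun s =>
      ∑ ij ∈ Finset.HasAntidiagonal.antidiagonal k, k.choose ij.1 •
        subsetConv (restrictMem a (d ij.1)) (partitionMultinomialSum d ij.2) s := by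
  ext s
  by_cases ha : a ∈ s
  · rw [restrictMem, if_pos ha, partitionMultinomialSum_of_mem d k ha]
  · rw [restrictMem, if_neg ha]
    refine (Finset.sum_eq_zero fun ij _ => ?_).symm
    rw [subsetConv, Finset.sum_eq_zero, smul_zero]
    intro A hA
    have haA : a ∉ A := fun h => ha (Finset.mem_powerset.1 hA h)
    simp [restrictMem, haA]

/-- The iterated derivatives of positive order of the cumulants of `u`. -/
def cumulantDeriv (D : K → K) (u : Finset α → K) (j : ℕ) (B : Finset α) : K :=
  if j = 0 then 0 else D^[j] (cumulant u B)

/-- The action of `D^k` on the exponential of the cumulants. -/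
theorem subsetConv_partitionMultinomialSum {D : K → K}
    (hadd : ∀ f g : K, D (f + g) = D f + D g)
    (hleib : ∀ f g : K, D (f * g) = D f * g + f * D g) (u : Finset α → K) (k : ℕ)
    (s : Finset α) :
    subsetConv (partitionMultinomialSum (cumulantDeriv D u) k) (unitalFamily u) s =
      D^[k] (unitalFamily u s) := by
  induction s using Finset.strongInduction generalizing k with
  | H s ih =>
  rcases s.eq_empty_or_nonempty with rfl | ⟨a, ha⟩
  · simp [subsetConv, partitionMultinomialSum, partitionsOf_empty, multinomialSum_empty,
      unitalFamily, iterate_one_of_leibniz hadd hleib]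
  have hD0 : ∀ j, D^[j] (0 : K) = 0 := fun j => by
    simpa using iterate_map_sum_of_add hadd (∅ : Finset ℕ) (fun _ => (0 : K)) j
  set Z := partitionMultinomialSum (cumulantDeriv D u) with hZ
  have hright : D^[k] (unitalFamily u s) =
      ∑ ij ∈ Finset.HasAntidiagonal.antidiagonal k, k.choose ij.1 •
        subsetConv (restrictMem a fun B => D^[ij.1] (cumulant u B))
          (fun B => D^[ij.2] (unitalFamily u B)) s := by
    have h := congrFun (subsetConv_restrictMem_cumulant a u) s
    conv_rhs at h => rw [restrictMem, if_pos ha]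
    rw [← h, subsetConv, iterate_map_sum_of_add hadd]
    simp only [subsetConv, Finset.smul_sum]
    rw [Finset.sum_comm]
    refine Finset.sum_congr rfl fun B _ => ?_
    rw [iterate_leibniz_of_add hadd hleib]
    refine Finset.sum_congr rfl fun ij _ => ?_
    by_cases haB : a ∈ B <;> simp [restrictMem, haB, hD0]
  have hleft : subsetConv (Z k) (unitalFamily u) s =
      (∑ ij ∈ Finset.HasAntidiagonal.antidiagonal k, k.choose ij.1 •
        subsetConv (restrictMem a (cumulantDeriv D u ij.1))
          (subsetConv (Z ij.2) (unitalFamily u)) s) +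
      subsetConv (restrictMem a (cumulant u)) (subsetConv (Z k) (unitalFamily u)) s := by
    have h := restrictMem_subsetConv a (Z k) (unitalFamily u) s
    conv_lhs at h => rw [restrictMem, if_pos ha]
    rw [h, ← subsetConv_restrictMem_cumulant a u, ← subsetConv_assoc,
      subsetConv_comm (Z k), subsetConv_assoc, hZ, restrictMem_partitionMultinomialSum]
    congr 1
    simp only [← subsetConv_assoc]
    simp only [subsetConv, Finset.sum_mul, Finset.smul_sum, smul_mul_assoc]
    rw [Finset.sum_comm]
  rw [hleft, hright]
  have hIH : ∀ (f : Finset α → K) (j : ℕ),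
      subsetConv (restrictMem a f) (subsetConv (Z j) (unitalFamily u)) s =
        subsetConv (restrictMem a f) (fun B => D^[j] (unitalFamily u B)) s := fun f j =>
    subsetConv_restrictMem_congr a f fun t ht => ih t ht j
  simp only [hIH]
  have h0 : (0, k) ∈ Finset.HasAntidiagonal.antidiagonal k := by simp
  rw [← Finset.add_sum_erase _ _ h0, ← Finset.add_sum_erase _ _ h0]
  have hzero : subsetConv (restrictMem a (cumulantDeriv D u 0))
      (fun B => D^[k] (unitalFamily u B)) s = 0 :=
    Finset.sum_eq_zero fun A _ => by simp [restrictMem, cumulantDeriv]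
  simp only [hzero, smul_zero, zero_add, Nat.choose_zero_right, one_smul, Function.iterate_zero,
    id]
  rw [add_comm]
  congr 1
  refine Finset.sum_congr rfl fun ij hij => ?_
  have hij0 : ij.1 ≠ 0 := by
    intro h
    obtain ⟨hne, hmem⟩ := Finset.mem_erase.1 hij
    have := Finset.HasAntidiagonal.mem_antidiagonal.1 hmem
    exact hne (Prod.ext h (by simpa [h] using this))
  have hd : cumulantDeriv D u ij.1 = fun B => D^[ij.1] (cumulant u B) :=
    funext fun B => if_neg hij0
  rw [hd]

/-- The multinomial sum of `cumulantDeriv`, written over positive exponents. -/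
theorem multinomialSum_cumulantDeriv (D : K → K) (u : Finset α → K)
    (π : Finset (Finset α)) (k : ℕ) :
    multinomialSum (cumulantDeriv D u) π k =
      ∑ β ∈ (Fintype.piFinset (fun _ : ↥π => Finset.range (k + 1))).filter
          (fun β => (∀ B, 0 < β B) ∧ ∑ B, β B = k),
        (Nat.factorial k / ∏ B, Nat.factorial (β B)) •
          ∏ B : ↥π, D^[β B] (cumulant u B.1) := by
  have hfilter : multinomialSum (cumulantDeriv D u) π k =
      ∑ β ∈ (π.piAntidiag k).filter (fun β => ∀ B ∈ π, 0 < β B),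
        Nat.multinomial π β • ∏ B ∈ π, cumulantDeriv D u (β B) B := by
    refine (Finset.sum_filter_of_ne fun β _ hne B hB => ?_).symm
    by_contra hβ
    refine hne ?_
    rw [Finset.prod_eq_zero hB, smul_zero]
    simp [cumulantDeriv, Nat.eq_zero_of_not_pos hβ]
  rw [hfilter]
  refine Finset.sum_bij' (fun β _ B => β B.1)
    (fun γ _ B => if h : B ∈ π then γ ⟨B, h⟩ else 0) ?_ ?_ ?_ ?_ ?_
  · intro β hβ
    simp only [Finset.mem_filter, Finset.mem_piAntidiag] at hβ
    obtain ⟨⟨hsum, -⟩, hpos⟩ := hβ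
    simp only [Finset.mem_filter, Fintype.mem_piFinset, Finset.mem_range]
    refine ⟨fun B => ?_, fun B => hpos B.1 B.2, ?_⟩
    · exact Nat.lt_succ_of_le (hsum ▸ Finset.single_le_sum (fun _ _ => Nat.zero_le _) B.2)
    · rw [← hsum, Finset.univ_eq_attach, Finset.sum_attach π β]
  · intro γ hγ
    simp only [Finset.mem_filter] at hγ
    obtain ⟨-, hpos, hsum⟩ := hγ
    simp only [Finset.mem_filter, Finset.mem_piAntidiag]
    refine ⟨⟨?_, fun B hB => ?_⟩, fun B hB => ?_⟩
    · rw [← hsum, Finset.univ_eq_attach, ← Finset.sum_attach π]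
      exact Finset.sum_congr rfl fun B _ => by simp
    · by_contra h
      simp [h] at hB
    · simpa [hB] using hpos ⟨B, hB⟩
  · intro β hβ
    simp only [Finset.mem_filter, Finset.mem_piAntidiag] at hβ
    ext B
    by_cases hB : B ∈ π
    · simp [hB]
    · have : β B = 0 := by
        by_contra h
        exact hB (hβ.1.2 B h)
      simp [hB, this]
  · intro γ _
    ext B
    simp
  · intro β hβ
    simp only [Finset.mem_filter, Finset.mem_piAntidiag] at hβ
    obtain ⟨⟨hsum, -⟩, hpos⟩ := hβ
    rw [Nat.multinomial, hsum, Finset.univ_eq_attach,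
      Finset.prod_attach π (fun B => (β B).factorial),
      Finset.prod_attach π (fun B => D^[β B] (cumulant u B))]
    congr 1
    refine Finset.prod_congr rfl fun B hB => ?_
    rw [cumulantDeriv, if_neg (hpos B hB).ne']

end Cumulant

/-- for a derivation `D` on a commutative ring `K` and positive integers
`r`, `k`, the deformed action `D̃^k κ_{[r]}(u) := Σ_π (−1)^{#π−1}(#π−1)! Σ_{B∈π}
(D^k u_B) ∏_{B'≠B} u_{B'}` equals
`Σ_{π, #π ≤ k} Σ_{α : π → ℕ_+, Σα = k} (k!/∏ α(B)!) ∏_{B∈π} D^{α(B)} κ_B(u)`. -/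
theorem deformed_derivative_of_cumulant {K : Type*} [CommRing K] (D : K → K)
    (hadd : ∀ f g : K, D (f + g) = D f + D g)
    (hleib : ∀ f g : K, D (f * g) = D f * g + f * D g)
    (r k : ℕ) (hr : 0 < r) (hk : 0 < k) (u : Finset (Fin r) → K) :
    ∑ π ∈ partitionsOf (Finset.univ : Finset (Fin r)),
      ((-1 : ℤ) ^ (π.card - 1) * (π.card - 1).factorial) •
        (∑ B ∈ π, D^[k] (u B) * ∏ B' ∈ π.erase B, u B')
    = ∑ π ∈ (partitionsOf (Finset.univ : Finset (Fin r))).filter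
          (fun π => π.card ≤ k),
        ∑ α ∈ (Fintype.piFinset (fun _ : ↥π => Finset.range (k + 1))).filter
            (fun α => (∀ B, 0 < α B) ∧ ∑ B, α B = k),
          (Nat.factorial k / ∏ B, Nat.factorial (α B)) •
            ∏ B : ↥π, D^[α B] (cumulant u B.1) := by
  have hcard : ∀ π ∈ partitionsOf (Finset.univ : Finset (Fin r)),
      multinomialSum (cumulantDeriv D u) π k ≠ 0 → π.card ≤ k := by
    intro π _ hne
    rw [multinomialSum_cumulantDeriv] at hne
    obtain ⟨β, hβ, -⟩ := Finset.exists_ne_zero_of_sum_ne_zero hne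
    obtain ⟨-, hpos, hsum⟩ := Finset.mem_filter.1 hβ
    calc π.card = ∑ _B : ↥π, 1 := by simp
      _ ≤ ∑ B : ↥π, β B := Finset.sum_le_sum fun B _ => hpos B
      _ = k := hsum
  simp only [← multinomialSum_cumulantDeriv]
  rw [Finset.sum_filter_of_ne hcard,
    sum_partitionsOf_marked u (fun B => D^[k] (u B)) Finset.univ]
  have hfun : (fun B : Finset (Fin r) => if B = ∅ then 0 else D^[k] (u B)) =
      subsetConv (partitionMultinomialSum (cumulantDeriv D u) k) (unitalFamily u) := by
    ext B
    rw [subsetConv_partitionMultinomialSum hadd hleib]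
    by_cases hB : B = ∅
    · simp [hB, unitalFamily, iterate_one_of_leibniz hadd hleib, hk.ne']
    · simp [hB, unitalFamily]
  rw [hfun, subsetConv_assoc, subsetConv_unitalFamily_inverseFamily, subsetConv_one]
  rfl
end

section
/- Let F be a field, C ∈ F with C ≠ 1, let K be a finite set, let c be a natural number and (c_i)_{i∈K} a family of natural numbers. For each subset I ⊆ K define v_I = 1 − C·q^{c + Σ_{i∈I} c_i}, an element of F(q). Then for every subset H ⊆ K, the rational function T_H(v) := (∏_{G⊆H} v_G^{(−1)^{|H|−|G|}}) − 1 satisfies T_H(v) = O_1((q−1)^{|H|}). -/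
/-- `f = O_c(g)`: the rational function `f/g` has no pole at `q = c`. -/
def IsOAt {F : Type*} [Field F] (c : F) (f g : RatFunc F) : Prop :=
  ∃ a b : Polynomial F, Polynomial.eval c b ≠ 0 ∧
    f * algebraMap (Polynomial F) (RatFunc F) b =
      g * algebraMap (Polynomial F) (RatFunc F) a

/-- The cumulative factorization error term
`T_H(u) = (∏_{G ⊆ H} u_G^{(−1)^{|H|−|G|}}) − 1`. -/
def Tfun {α F : Type*} [DecidableEq α] [Field F] (u : Finset α → F) (H : Finset α) : F :=
  (∏ G ∈ H.powerset, u G ^ ((-1 : ℤ) ^ (H.card - G.card))) - 1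

open Polynomial in
/-- Multiplying the variable by `x` changes nothing modulo a divisor of `x - 1`. -/
lemma C_dvd_comp_C_mul_X_sub {R : Type*} [CommRing R] {t x : R} (h : t ∣ x - 1) (g : R[X]) :
    C t ∣ g.comp (C x * X) - g := by
  have h1 : C x * X - X ∣ g.comp (C x * X) - g := by
    simpa [eval_map, comp, eval₂_C_X] using sub_dvd_eval_sub (C x * X) X (g.map C)
  refine Dvd.dvd.trans ?_ h1
  obtain ⟨y, hy⟩ := h
  refine ⟨C y * X, ?_⟩
  rw [← mul_assoc, ← C_mul, ← hy, C_sub, C_1]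
  ring

/-- The alternating product over the subsets of `insert i H` splits into two alternating
products over the subsets of `H`. -/
lemma prod_powerset_insert_zpow {α K : Type*} [DecidableEq α] [Field K] (u : Finset α → K)
    {i : α} {H : Finset α} (hi : i ∉ H) :
    ∏ G ∈ (insert i H).powerset, u G ^ ((-1 : ℤ) ^ ((insert i H).card - G.card)) =
      (∏ G ∈ H.powerset, u G ^ ((-1 : ℤ) ^ (H.card - G.card)))⁻¹ *
        ∏ G ∈ H.powerset, u (insert i G) ^ ((-1 : ℤ) ^ (H.card - G.card)) := by
  rw [Finset.prod_powerset_insert hi, ← Finset.prod_inv_distrib]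
  congr 1
  · refine Finset.prod_congr rfl fun G hG => ?_
    have hle := Finset.card_le_card (Finset.mem_powerset.1 hG)
    rw [Finset.card_insert_of_notMem hi, Nat.sub_add_comm hle, pow_succ, mul_neg_one, zpow_neg]
  · refine Finset.prod_congr rfl fun G hG => ?_
    have hiG : i ∉ G := fun h => hi (Finset.mem_powerset.1 hG h)
    rw [Finset.card_insert_of_notMem hi, Finset.card_insert_of_notMem hiG,
      Nat.add_sub_add_right]

open Polynomial in
/-- The alternating product of the factors `1 - b ∏ xᵢ` is a quotient `P(b) / Q(b)` of
polynomials in `b` which do not vanish at `1` and whose difference is divisible by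
`t ^ |H|`, where `t` divides every `xᵢ - 1`. -/
lemma exists_alternating_prod_eq_div {F ι : Type*} [Field F] [DecidableEq ι] {e : F}
    (he : e ≠ 1) (t : F[X]) (x : ι → F[X]) (ht : ∀ i, t ∣ x i - 1)
    (hx : ∀ i, (x i).eval 1 = 1) (H : Finset ι) :
    ∃ P Q : F[X][X], C (t ^ H.card) ∣ P - Q ∧ ∀ b : F[X], b.eval 1 = e →
      (P.eval b).eval 1 ≠ 0 ∧ (Q.eval b).eval 1 ≠ 0 ∧
      ∏ G ∈ H.powerset, (algebraMap F[X] (RatFunc F) (1 - b * ∏ i ∈ G, x i)) ^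
        ((-1 : ℤ) ^ (H.card - G.card)) =
      algebraMap F[X] (RatFunc F) (P.eval b) / algebraMap F[X] (RatFunc F) (Q.eval b) := by
  induction H using Finset.induction_on with
  | empty =>
    refine ⟨1 - X, 1, by simp, fun b hb => ⟨?_, by simp, by simp⟩⟩
    simpa [hb, sub_eq_zero] using he.symm
  | insert i H hi ih =>
    obtain ⟨P, Q, ⟨g, hg⟩, hPQ⟩ := ih
    refine ⟨P.comp (C (x i) * X) * Q, Q.comp (C (x i) * X) * P, ?_, fun b hb => ?_⟩
    · obtain ⟨y, hy⟩ := C_dvd_comp_C_mul_X_sub (ht i) g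
      obtain ⟨z, hz⟩ := C_dvd_comp_C_mul_X_sub (ht i) Q
      have hc : P.comp (C (x i) * X) - Q.comp (C (x i) * X) =
          C (t ^ H.card) * g.comp (C (x i) * X) := by
        rw [← sub_comp, hg, mul_comp, C_comp]
      refine ⟨y * Q - z * g, ?_⟩
      rw [Finset.card_insert_of_notMem hi, pow_succ, C_mul]
      linear_combination Q * hc - Q.comp (C (x i) * X) * hg +
        C (t ^ H.card) * Q * hy - C (t ^ H.card) * g * hz
    · obtain ⟨hP, hQ, h⟩ := hPQ b hb
      obtain ⟨hP', hQ', h'⟩ := hPQ (x i * b) (by simp [hx, hb])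
      simp only [eval_mul, eval_comp, eval_C, eval_X]
      refine ⟨mul_ne_zero hP' hQ, mul_ne_zero hQ' hP, ?_⟩
      have hsplit : ∏ G ∈ H.powerset,
          (algebraMap F[X] (RatFunc F) (1 - b * ∏ j ∈ insert i G, x j)) ^
            ((-1 : ℤ) ^ (H.card - G.card)) =
          ∏ G ∈ H.powerset, (algebraMap F[X] (RatFunc F) (1 - x i * b * ∏ j ∈ G, x j)) ^
            ((-1 : ℤ) ^ (H.card - G.card)) := by
        refine Finset.prod_congr rfl fun G hG => ?_
        rw [Finset.prod_insert fun hiG => hi (Finset.mem_powerset.1 hG hiG), mul_left_comm,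
          mul_assoc]
      rw [prod_powerset_insert_zpow
        (fun G => algebraMap F[X] (RatFunc F) (1 - b * ∏ j ∈ G, x j)) hi, hsplit, h, h',
        inv_div, div_mul_div_comm, map_mul, map_mul]
      ring

/-- for `C ≠ 1` and `v_I = 1 − C·q^{c + Σ_{i∈I} c_i}`, for every subset
`H` of the finite index set one has `T_H(v) = O_1((q−1)^{|H|})`. -/
theorem Tfun_of_geometric_family {F : Type*} [Field F] {ι : Type*} [Fintype ι]
    [DecidableEq ι] (C : F) (hC : C ≠ 1) (c : ℕ) (ci : ι → ℕ) (H : Finset ι) :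
    IsOAt (1 : F)
      (Tfun (fun I : Finset ι =>
        1 - RatFunc.C C * RatFunc.X ^ (c + ∑ i ∈ I, ci i)) H)
      ((RatFunc.X - 1) ^ H.card) := by
  obtain ⟨P, Q, ⟨g, hg⟩, h⟩ := exists_alternating_prod_eq_div hC (Polynomial.X - 1)
    (fun i => Polynomial.X ^ ci i) (fun i => sub_one_dvd_pow_sub_one _ _) (by simp) H
  obtain ⟨-, hQ, h⟩ := h (Polynomial.C C * Polynomial.X ^ c) (by simp)
  set b := Polynomial.C C * Polynomial.X ^ c
  have hQ0 : algebraMap (Polynomial F) (RatFunc F) (Q.eval b) ≠ 0 := by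
    refine RatFunc.algebraMap_ne_zero fun h0 => hQ ?_
    rw [h0, Polynomial.eval_zero]
  refine ⟨g.eval b, Q.eval b, hQ, ?_⟩
  have hv : ∀ G : Finset ι, 1 - RatFunc.C C * RatFunc.X ^ (c + ∑ i ∈ G, ci i) =
      algebraMap (Polynomial F) (RatFunc F) (1 - b * ∏ i ∈ G, Polynomial.X ^ ci i) := by
    intro G
    simp [b, Finset.prod_pow_eq_pow_sum, pow_add, mul_assoc]
  have hPQ : P.eval b - Q.eval b = (Polynomial.X - 1) ^ H.card * g.eval b := by
    rw [← Polynomial.eval_sub, hg, Polynomial.eval_mul, Polynomial.eval_C]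
  simp only [Tfun, hv]
  rw [h, sub_mul, div_mul_cancel₀ _ hQ0, one_mul, ← map_sub, hPQ]
  simp
end

section
/- Let R be a commutative ring, C ∈ R, K a finite set, c a natural number, and (c_i)_{i∈K} a family of natural numbers. In the polynomial ring R[q] put R_ev = ∏_{δ⊆K, |δ| even} (1 − C·q^{c + Σ_{i∈δ} c_i}) and R_odd = ∏_{δ⊆K, |δ| odd} (1 − C·q^{c + Σ_{i∈δ} c_i}), the products running over all subsets δ of K of even (respectively odd) cardinality. Then (q − 1)^{|K|} divides R_ev − R_odd in R[q]. -/
open Polynomial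

/-- Replacing the variable `X` by `r * X` changes a polynomial by a multiple of `r - 1`. -/
theorem Polynomial.C_sub_one_dvd_comp_C_mul_X_sub {S : Type*} [CommRing S] (r : S) (p : S[X]) :
    C (r - 1) ∣ p.comp (C r * X) - p := by
  have h := sub_dvd_eval_sub (C r * X) X (p.map C)
  rw [eval_map, eval_map, ← comp, ← comp, comp_X] at h
  refine Dvd.dvd.trans ⟨X, ?_⟩ h
  simp only [map_sub, map_one]
  ring

/-- The product of `1 - (∏ i ∈ δ, x i) * X` over the subsets `δ` of `s` satisfying `P #δ`. -/
noncomputable def subsetProduct {S ι : Type*} [CommRing S] (x : ι → S) (P : ℕ → Prop)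
    [DecidablePred P] (s : Finset ι) : S[X] :=
  ∏ δ ∈ s.powerset with P δ.card, (1 - C (∏ i ∈ δ, x i) * X)

theorem subsetProduct_insert {S ι : Type*} [CommRing S] [DecidableEq ι] (x : ι → S)
    (P Q : ℕ → Prop) [DecidablePred P] [DecidablePred Q] (hPQ : ∀ n, P (n + 1) ↔ Q n)
    {s : Finset ι} {j : ι} (hj : j ∉ s) :
    subsetProduct x P (insert j s) =
      subsetProduct x P s * (subsetProduct x Q s).comp (C (x j) * X) := by
  simp only [subsetProduct, prod_comp, Finset.prod_filter, Finset.prod_powerset_insert hj]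
  congr 1
  refine Finset.prod_congr rfl fun δ hδ => ?_
  have hjδ : j ∉ δ := fun h => hj (Finset.mem_powerset.mp hδ h)
  rw [Finset.card_insert_of_notMem hjδ, Finset.prod_insert hjδ]
  simp only [hPQ]
  split_ifs
  · simp only [sub_comp, one_comp, mul_comp, C_comp, X_comp, map_mul]
    ring
  · simp

theorem C_prod_sub_one_dvd_subsetProduct_sub {S ι : Type*} [CommRing S] [DecidableEq ι]
    (x : ι → S) (s : Finset ι) :
    C (∏ i ∈ s, (x i - 1)) ∣ subsetProduct x Even s - subsetProduct x Odd s := by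
  induction s using Finset.induction_on with
  | empty => simp
  | insert j s hj ih =>
    rw [subsetProduct_insert x Even Odd (by simp [Nat.even_add_one]) hj,
      subsetProduct_insert x Odd Even (by simp [Nat.odd_add_one]) hj,
      Finset.prod_insert hj]
    set B := subsetProduct x Odd s
    obtain ⟨G, hG⟩ := ih
    rw [sub_eq_iff_eq_add.mp hG]
    obtain ⟨U, hU⟩ := C_sub_one_dvd_comp_C_mul_X_sub (x j) B
    obtain ⟨V, hV⟩ := C_sub_one_dvd_comp_C_mul_X_sub (x j) G
    refine ⟨G * U - V * B, ?_⟩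
    simp only [add_comp, mul_comp, C_comp]
    rw [sub_eq_iff_eq_add.mp hU, sub_eq_iff_eq_add.mp hV, map_mul]
    ring

/-- With `R_ev = ∏_{δ⊆K, |δ| even} (1 − C·q^{c + Σ_{i∈δ} c_i})` and
`R_odd = ∏_{δ⊆K, |δ| odd} (1 − C·q^{c + Σ_{i∈δ} c_i})` in `R[q]`,
`(q − 1)^{|K|}` divides `R_ev − R_odd`. -/
theorem qsub_one_pow_dvd_even_odd_product_difference
    {R : Type*} [CommRing R] {ι : Type*} [Fintype ι] [DecidableEq ι]
    (C : R) (c : ℕ) (ci : ι → ℕ) :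
    ((Polynomial.X - 1 : Polynomial R)) ^ (Fintype.card ι) ∣
      (∏ δ ∈ Finset.univ.filter (fun δ : Finset ι => Even δ.card),
          (1 - Polynomial.C C * Polynomial.X ^ (c + ∑ i ∈ δ, ci i)))
        - ∏ δ ∈ Finset.univ.filter (fun δ : Finset ι => Odd δ.card),
            (1 - Polynomial.C C * Polynomial.X ^ (c + ∑ i ∈ δ, ci i)) := by
  have h := map_dvd (evalRingHom (Polynomial.C C * X ^ c))
    (C_prod_sub_one_dvd_subsetProduct_sub (fun i => (X : R[X]) ^ ci i) Finset.univ)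
  have hX : ((X - 1 : R[X])) ^ Fintype.card ι ∣ ∏ i, (X ^ ci i - 1) := by
    rw [← Finset.card_univ, ← Finset.prod_const]
    exact Finset.prod_dvd_prod_of_dvd _ _ fun i _ => sub_one_dvd_pow_sub_one X (ci i)
  simp only [subsetProduct, Finset.powerset_univ, coe_evalRingHom, eval_C, eval_sub, eval_prod,
    eval_one, eval_mul, eval_X, Finset.prod_pow_eq_pow_sum] at h
  refine (hX.trans h).trans (dvd_of_eq ?_)
  congr 1 <;> exact Finset.prod_congr rfl fun δ _ => by ring
end

section
/- Let F = ℚ(t) be the field of rational functions in the variable t over ℚ, and work in the field F(q) of rational functions in q over F. Fix a positive integer r and partitions λ^1,…,λ^r, and for each subset I ⊆ [r] set u_I = h_{(q,t)}(λ^I), where λ^I = ⊕_{i∈I} λ^i. Then the family (u_I) has the strong factorization property at q = 1: for every subset H ⊆ [r] with |H| ≥ 2, T_H(u) = O_1((q−1)^{|H|−1}). -/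
/-- A partition encoded as a weakly decreasing function `ℕ → ℕ` with finite support. -/
structure PartitionFun where
  toFun : ℕ → ℕ
  antitone' : ∀ ⦃i j : ℕ⦄, i ≤ j → toFun j ≤ toFun i
  finite_support' : (Function.support toFun).Finite

/-- The entry-wise sum `λ^I = ⊕_{k ∈ I} λ^k` of a family of partitions. -/
def partSum {r : ℕ} (lam : Fin r → PartitionFun) (I : Finset (Fin r)) : PartitionFun where
  toFun := fun n => ∑ k ∈ I, (lam k).toFun n
  antitone' := fun i j hij => Finset.sum_le_sum fun k _ => (lam k).antitone' hij
  finite_support' := by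
    apply Set.Finite.subset
      (Set.Finite.biUnion I.finite_toSet fun k _ => (lam k).finite_support')
    intro n hn
    obtain ⟨k, hk, hk0⟩ :=
      Finset.exists_ne_zero_of_sum_ne_zero (Function.mem_support.mp hn)
    exact Set.mem_biUnion hk hk0

/-- The `(q,t)`-hook polynomial `h_{(q,t)}(λ) = ∏_{(i,j) ∈ λ} (1 − q^{a(i,j)} t^{ℓ(i,j)+1})`,
an element of `F(q)` where `F = ℚ(t)`; the cells of `λ` are the pairs `(i,j)` with
`j < λ(i)`, the arm-length is `a(i,j) = λ(i) − j − 1` and the leg-length is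
`ℓ(i,j) = #{i' : λ(i') > j} − i − 1`. -/
noncomputable def hookPoly (lam : PartitionFun) : RatFunc (RatFunc ℚ) :=
  ∏ᶠ (p : ℕ × ℕ) (_ : p.2 < lam.toFun p.1),
    (1 - (RatFunc.X : RatFunc (RatFunc ℚ)) ^ (lam.toFun p.1 - p.2 - 1) *
      RatFunc.C (RatFunc.X : RatFunc ℚ) ^
        ({i' : ℕ | p.2 < lam.toFun i'}.ncard - p.1 - 1 + 1))

/-- `x = N / D` with `N`, `D` nonvanishing at `1` and congruent modulo `(q - 1) ^ k`. -/
def IsOneModPow {F : Type*} [Field F] (k : ℕ) (x : RatFunc F) : Prop :=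
  ∃ N D : Polynomial F, N.eval 1 ≠ 0 ∧ D.eval 1 ≠ 0 ∧ (Polynomial.X - 1) ^ k ∣ N - D ∧
    x = algebraMap (Polynomial F) (RatFunc F) N / algebraMap (Polynomial F) (RatFunc F) D

namespace IsOneModPow

variable {F : Type*} [Field F] {k : ℕ} {x y : RatFunc F}

lemma one : IsOneModPow k (1 : RatFunc F) :=
  ⟨1, 1, by simp, by simp, by simp, by simp⟩

lemma mul (hx : IsOneModPow k x) (hy : IsOneModPow k y) : IsOneModPow k (x * y) := by
  obtain ⟨N, D, hN, hD, h, rfl⟩ := hx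
  obtain ⟨N', D', hN', hD', h', rfl⟩ := hy
  refine ⟨N * N', D * D', by simp [hN, hN'], by simp [hD, hD'], ?_, by
    simp [div_mul_div_comm]⟩
  have : N * N' - D * D' = (N - D) * N' + D * (N' - D') := by ring
  rw [this]
  exact dvd_add (h.mul_right _) (h'.mul_left _)

lemma inv (hx : IsOneModPow k x) : IsOneModPow k x⁻¹ := by
  obtain ⟨N, D, hN, hD, h, rfl⟩ := hx
  exact ⟨D, N, hD, hN, (dvd_sub_comm).1 h, by simp⟩

lemma div (hx : IsOneModPow k x) (hy : IsOneModPow k y) : IsOneModPow k (x / y) := by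
  rw [div_eq_mul_inv]
  exact hx.mul hy.inv

lemma prod {ι : Type*} {s : Finset ι} {f : ι → RatFunc F}
    (hf : ∀ i ∈ s, IsOneModPow k (f i)) : IsOneModPow k (∏ i ∈ s, f i) :=
  Finset.prod_induction f (IsOneModPow k) (fun _ _ => mul) one hf

lemma isOAt_sub_one (hx : IsOneModPow k x) :
    IsOAt (1 : F) (x - 1) ((RatFunc.X - 1) ^ k) := by
  obtain ⟨N, D, -, hD, ⟨E, hE⟩, rfl⟩ := hx
  refine ⟨E, D, hD, ?_⟩
  have hD0 : algebraMap (Polynomial F) (RatFunc F) D ≠ 0 := by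
    refine RatFunc.algebraMap_ne_zero ?_
    rintro rfl
    simp at hD
  have h := congrArg (algebraMap (Polynomial F) (RatFunc F)) hE
  rw [sub_mul, div_mul_cancel₀ _ hD0, one_mul, ← map_sub, h]
  simp [RatFunc.algebraMap_X]

end IsOneModPow

/-- The iterated multiplicative difference of `f` at `n` with steps `d i`, `i ∈ H`. -/
def altProd {α K : Type*} [Field K] (d : α → ℕ) (H : Finset α) (f : ℕ → K) (n : ℕ) : K :=
  ∏ G ∈ H.powerset, f (n + ∑ i ∈ G, d i) ^ ((-1 : ℤ) ^ (H.card - G.card))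

section altProd

variable {α K : Type*} [Field K] (d : α → ℕ) (H : Finset α)

lemma altProd_div (f g : ℕ → K) (n : ℕ) :
    altProd d H (fun m => f m / g m) n = altProd d H f n / altProd d H g n := by
  simp [altProd, div_zpow, Finset.prod_div_distrib]

lemma altProd_prod {ι : Type*} (s : Finset ι) (f : ι → ℕ → K) (n : ℕ) :
    altProd d H (fun m => ∏ b ∈ s, f b m) n = ∏ b ∈ s, altProd d H (f b) n := by
  simp only [altProd, ← Finset.prod_zpow]
  exact Finset.prod_comm

lemma altProd_add (f : ℕ → K) (m n : ℕ) :
    altProd d H (fun k => f (k + m)) n = altProd d H f (n + m) := by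
  simp [altProd, add_right_comm]

lemma altProd_insert [DecidableEq α] {a : α} (ha : a ∉ H) (f : ℕ → K) (n : ℕ) :
    altProd d (insert a H) f n = altProd d H f (n + d a) / altProd d H f n := by
  have hsub : ∀ G ∈ H.powerset, a ∉ G ∧ G.card ≤ H.card := fun G hG =>
    ⟨fun h => ha (Finset.mem_powerset.1 hG h), Finset.card_le_card (Finset.mem_powerset.1 hG)⟩
  rw [altProd, Finset.prod_powerset_insert ha, mul_comm, div_eq_mul_inv]
  congr 1
  · refine Finset.prod_congr rfl fun G hG => ?_
    rw [Finset.sum_insert (hsub G hG).1, Finset.card_insert_of_notMem ha,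
      Finset.card_insert_of_notMem (hsub G hG).1, Nat.add_sub_add_right, add_assoc]
  · rw [altProd, ← Finset.prod_inv_distrib]
    refine Finset.prod_congr rfl fun G hG => ?_
    rw [Finset.card_insert_of_notMem ha, Nat.succ_sub (hsub G hG).2, pow_succ, mul_neg_one,
      zpow_neg]

end altProd

section qShifted

open Polynomial

variable {F : Type*} [Field F]

lemma C_X_sub_one_dvd_comp_sub (p : F[X][X]) (m : ℕ) :
    (C (X - 1) : F[X][X]) ∣ p.comp (C (X ^ m) * X) - p := by
  have h1 : (C (X - 1) : F[X][X]) ∣ C (X ^ m) * X - X := by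
    have : (C (X ^ m) * X - X : F[X][X]) = C (X ^ m - 1) * X := by simp [sub_mul]
    rw [this]
    exact (_root_.map_dvd C (by simpa using sub_dvd_pow_sub_pow (X : F[X]) 1 m)).mul_right _
  refine h1.trans ?_
  have h2 := sub_dvd_eval_sub (C (X ^ m) * X : F[X][X]) X (p.map C)
  rwa [eval_map, eval_map, ← comp, ← comp, comp_X] at h2

lemma eval_one_eval_X_pow (p : F[X][X]) (n : ℕ) :
    (p.eval (X ^ n)).eval 1 = (p.eval 1).eval 1 := by
  obtain ⟨e, he⟩ := sub_dvd_eval_sub (X ^ n : F[X]) 1 p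
  have := congrArg (eval 1) he
  simpa [sub_eq_zero] using this

lemma exists_altProd_eq_eval_div_eval {α : Type*} [DecidableEq α] (d : α → ℕ) (H : Finset α)
    {c : F} (hc : c ≠ 1) :
    ∃ N D : F[X][X], C (X - 1) ^ H.card ∣ N - D ∧
      (N.eval 1).eval 1 ≠ 0 ∧ (D.eval 1).eval 1 ≠ 0 ∧
      ∀ n, altProd d H (fun n => (1 - RatFunc.X ^ n * RatFunc.C c : RatFunc F)) n =
        algebraMap F[X] (RatFunc F) (N.eval (X ^ n)) /
          algebraMap F[X] (RatFunc F) (D.eval (X ^ n)) := by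
  induction H using Finset.induction_on with
  | empty =>
    refine ⟨1 - X * C (C c), 1, by simp, ?_, by simp, fun n => ?_⟩
    · simpa [sub_eq_zero] using hc.symm
    · simp [altProd, RatFunc.algebraMap_X, RatFunc.algebraMap_C, -X_pow_mul_C, -X_mul_C]
  | insert a H ha ih =>
    obtain ⟨N, D, ⟨E, hE⟩, hN, hD, h⟩ := ih
    set s : F[X][X] := C (X ^ d a) * X with hs
    have hev : ∀ (p : F[X][X]) (n : ℕ), (p.comp s).eval (X ^ n) = p.eval (X ^ (n + d a)) := by
      intro p n
      simp [hs, eval_comp, pow_add, mul_comm]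
    have hev1 : ∀ p : F[X][X], ((p.comp s).eval 1).eval 1 = (p.eval 1).eval 1 := by
      intro p
      rw [← pow_zero (X : F[X]), hev, eval_one_eval_X_pow, pow_zero]
    refine ⟨N.comp s * D, D.comp s * N, ?_, ?_, ?_, fun n => ?_⟩
    · have hN' : N = D + C (X - 1) ^ H.card * E := by rw [← hE]; ring
      have key : N.comp s * D - D.comp s * N =
          C (X - 1) ^ H.card * ((E.comp s - E) * D - (D.comp s - D) * E) := by
        rw [hN']
        simp only [add_comp, mul_comp, pow_comp, C_comp]
        ring
      rw [key, Finset.card_insert_of_notMem ha, pow_succ]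
      exact mul_dvd_mul_left _ (dvd_sub ((C_X_sub_one_dvd_comp_sub E _).mul_right _)
        ((C_X_sub_one_dvd_comp_sub D _).mul_right _))
    · rw [eval_mul, eval_mul, hev1]
      exact mul_ne_zero hN hD
    · rw [eval_mul, eval_mul, hev1]
      exact mul_ne_zero hD hN
    · rw [altProd_insert _ _ ha, h, h, eval_mul, eval_mul, hev, hev, map_mul, map_mul,
        div_div_div_eq]

lemma isOneModPow_altProd {α : Type*} [DecidableEq α] (d : α → ℕ) (H : Finset α)
    {c : F} (hc : c ≠ 1) (n : ℕ) :
    IsOneModPow H.card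
      (altProd d H (fun n => (1 - RatFunc.X ^ n * RatFunc.C c : RatFunc F)) n) := by
  obtain ⟨N, D, hdvd, hN, hD, h⟩ := exists_altProd_eq_eval_div_eval d H hc
  refine ⟨N.eval (X ^ n), D.eval (X ^ n), ?_, ?_, ?_, h n⟩
  · rwa [eval_one_eval_X_pow]
  · rwa [eval_one_eval_X_pow]
  · simpa using _root_.map_dvd (evalRingHom (X ^ n : F[X])) hdvd

/-- The `q`-shifted factorial `∏_{a < n} (1 - q ^ a c)`. -/
noncomputable def qShifted (c : F) (n : ℕ) : RatFunc F :=
  ∏ a ∈ Finset.range n, (1 - RatFunc.X ^ a * RatFunc.C c)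

lemma one_sub_X_pow_mul_C_ne_zero {c : F} (hc : c ≠ 1) (n : ℕ) :
    (1 - RatFunc.X ^ n * RatFunc.C c : RatFunc F) ≠ 0 := by
  have h : (1 - RatFunc.X ^ n * RatFunc.C c : RatFunc F) =
      algebraMap F[X] (RatFunc F) (1 - X ^ n * C c) := by
    simp [RatFunc.algebraMap_X, RatFunc.algebraMap_C, -X_pow_mul_C, -X_mul_C]
  rw [h]
  refine RatFunc.algebraMap_ne_zero fun h0 => ?_
  have := congrArg (eval 1) h0
  simp [sub_eq_zero] at this
  exact hc this.symm

lemma qShifted_ne_zero {c : F} (hc : c ≠ 1) (n : ℕ) : qShifted c n ≠ 0 :=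
  Finset.prod_ne_zero_iff.2 fun _ _ => one_sub_X_pow_mul_C_ne_zero hc _

lemma isOneModPow_altProd_qShifted {α : Type*} [DecidableEq α] (d : α → ℕ) {H : Finset α}
    (hH : H.Nonempty) {c : F} (hc : c ≠ 1) (n : ℕ) :
    IsOneModPow (H.card - 1) (altProd d H (qShifted c) n) := by
  obtain ⟨a, ha⟩ := hH
  obtain ⟨H, haH, rfl⟩ : ∃ H', a ∉ H' ∧ insert a H' = H :=
    ⟨H.erase a, Finset.notMem_erase a H, Finset.insert_erase ha⟩
  have hdiv : ∀ m, qShifted c (m + d a) / qShifted c m =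
      ∏ b ∈ Finset.range (d a), (1 - RatFunc.X ^ (m + b) * RatFunc.C c : RatFunc F) := by
    intro m
    rw [div_eq_iff (qShifted_ne_zero hc m), qShifted, Finset.prod_range_add, mul_comm]
    rfl
  rw [altProd_insert _ _ haH, ← altProd_add, ← altProd_div, Finset.card_insert_of_notMem haH,
    Nat.add_sub_cancel]
  simp only [hdiv]
  rw [altProd_prod]
  refine IsOneModPow.prod fun b _ => ?_
  have := altProd_add d H (fun n => (1 - RatFunc.X ^ n * RatFunc.C c : RatFunc F)) b n
  rw [this]
  exact isOneModPow_altProd d H hc _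

lemma prod_Ico_eq_qShifted (c : F) {b a : ℕ} (h : b ≤ a) :
    ∏ j ∈ Finset.Ico b a, (1 - RatFunc.X ^ (a - j - 1) * RatFunc.C c : RatFunc F) =
      qShifted c (a - b) := by
  rw [Finset.prod_Ico_eq_prod_range, qShifted, ← Finset.prod_range_reflect]
  refine Finset.prod_congr rfl fun j hj => ?_
  have := Finset.mem_range.1 hj
  congr 3
  omega

lemma prod_Ico_eq_qShifted_div {c : F} (hc : c ≠ 1) {b m a : ℕ} (hbm : b ≤ m) (hma : m ≤ a) :
    ∏ j ∈ Finset.Ico b m, (1 - RatFunc.X ^ (a - j - 1) * RatFunc.C c : RatFunc F) =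
      qShifted c (a - b) / qShifted c (a - m) := by
  rw [eq_div_iff (qShifted_ne_zero hc _), ← prod_Ico_eq_qShifted c hma,
    ← prod_Ico_eq_qShifted c (hbm.trans hma), Finset.prod_Ico_consecutive _ hbm hma]

end qShifted

lemma ratFunc_X_pow_ne_one {m : ℕ} (hm : m ≠ 0) : (RatFunc.X : RatFunc ℚ) ^ m ≠ 1 := by
  rw [← RatFunc.algebraMap_X, ← map_pow, ← map_one (algebraMap (Polynomial ℚ) (RatFunc ℚ))]
  intro h
  have := congrArg Polynomial.natDegree (RatFunc.algebraMap_injective ℚ h)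
  simp [hm] at this

namespace PartitionFun

variable (lam : PartitionFun)

lemma ncard_eq {j m : ℕ} (h1 : lam.toFun (m + 1) ≤ j) (h2 : j < lam.toFun m) :
    {i' : ℕ | j < lam.toFun i'}.ncard = m + 1 := by
  have : {i' : ℕ | j < lam.toFun i'} = (Finset.range (m + 1) : Set ℕ) := by
    ext i
    simp only [Set.mem_ofPred_eq, Finset.coe_range, Set.mem_Iio]
    constructor
    · intro h
      by_contra! hi
      exact absurd (h.trans_le (lam.antitone' hi)) (by omega)
    · intro h
      exact h2.trans_le (lam.antitone' (Nat.lt_succ_iff.1 h))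
  rw [this, Set.ncard_coe_finset, Finset.card_range]

lemma prod_row {i m : ℕ} (him : i ≤ m) :
    ∏ j ∈ Finset.Ico (lam.toFun m) (lam.toFun i),
      (1 - (RatFunc.X : RatFunc (RatFunc ℚ)) ^ (lam.toFun i - j - 1) *
        RatFunc.C (RatFunc.X : RatFunc ℚ) ^ ({i' : ℕ | j < lam.toFun i'}.ncard - i - 1 + 1)) =
      ∏ k ∈ Finset.Ico i m,
        (qShifted ((RatFunc.X : RatFunc ℚ) ^ (k - i + 1)) (lam.toFun i - lam.toFun (k + 1)) /
          qShifted ((RatFunc.X : RatFunc ℚ) ^ (k - i + 1)) (lam.toFun i - lam.toFun k)) := by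
  induction m, him using Nat.le_induction with
  | base => simp
  | succ m him ih =>
    rw [Finset.prod_Ico_succ_top him, ← ih,
      ← Finset.prod_Ico_consecutive _ (lam.antitone' m.le_succ) (lam.antitone' him), mul_comm,
      ← prod_Ico_eq_qShifted_div (ratFunc_X_pow_ne_one (Nat.succ_ne_zero _))
        (lam.antitone' m.le_succ) (lam.antitone' him)]
    congr 1
    refine Finset.prod_congr rfl fun j hj => ?_
    rw [Finset.mem_Ico] at hj
    rw [lam.ncard_eq hj.1 hj.2, map_pow]
    congr 3
    omega

lemma hookPoly_eq {L : ℕ} (hL : lam.toFun L = 0) :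
    hookPoly lam = ∏ i ∈ Finset.range L, ∏ k ∈ Finset.Ico i L,
      (qShifted ((RatFunc.X : RatFunc ℚ) ^ (k - i + 1)) (lam.toFun i - lam.toFun (k + 1)) /
        qShifted ((RatFunc.X : RatFunc ℚ) ^ (k - i + 1)) (lam.toFun i - lam.toFun k)) := by
  have hrow : ∀ i ∈ Finset.range L, _ := fun i hi =>
    lam.prod_row (Finset.mem_range.1 hi).le
  rw [← Finset.prod_congr rfl hrow, hL, Finset.prod_sigma']
  simp only [Nat.Ico_zero_eq_range]
  refine Eq.trans ?_ (Finset.prod_map _ (Equiv.sigmaEquivProd ℕ ℕ).toEmbedding fun p : ℕ × ℕ =>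
    (1 - (RatFunc.X : RatFunc (RatFunc ℚ)) ^ (lam.toFun p.1 - p.2 - 1) *
      RatFunc.C (RatFunc.X : RatFunc ℚ) ^
        ({i' : ℕ | p.2 < lam.toFun i'}.ncard - p.1 - 1 + 1)))
  refine finprod_mem_eq_prod_of_inter_mulSupport_eq (s := {p : ℕ × ℕ | p.2 < lam.toFun p.1}) _ ?_
  congr 1
  ext ⟨i, j⟩
  simp only [Set.mem_ofPred_eq, SetLike.mem_coe, Finset.mem_map_equiv, Finset.mem_sigma,
    Finset.mem_range, Equiv.sigmaEquivProd_symm_apply]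
  refine ⟨fun h => ⟨?_, h⟩, And.right⟩
  by_contra! hi
  have := lam.antitone' hi
  omega

end PartitionFun

lemma exists_forall_toFun_eq_zero {r : ℕ} (lam : Fin r → PartitionFun) :
    ∃ L, ∀ m, (lam m).toFun L = 0 := by
  have hfin := Set.finite_iUnion fun m => (lam m).finite_support'
  obtain ⟨L, hL⟩ := hfin.exists_notMem
  refine ⟨L, fun m => ?_⟩
  by_contra h
  exact hL (Set.mem_iUnion.2 ⟨m, h⟩)

lemma partSum_sub {r : ℕ} (lam : Fin r → PartitionFun) (G : Finset (Fin r)) {i k : ℕ}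
    (h : i ≤ k) : (partSum lam G).toFun i - (partSum lam G).toFun k =
      ∑ m ∈ G, ((lam m).toFun i - (lam m).toFun k) :=
  (Finset.sum_tsub_distrib G fun m _ => (lam m).antitone' h).symm

/-- the family `u_I = h_{(q,t)}(λ^I)` has the strong factorization
property at `q = 1`: for every `H ⊆ [r]` with `|H| ≥ 2`,
`T_H(u) = O_1((q−1)^{|H|−1})`. -/
theorem hook_strong_factorization (r : ℕ) (hr : 0 < r) (lam : Fin r → PartitionFun)
    (H : Finset (Fin r)) (hH : 2 ≤ H.card) :
    IsOAt (1 : RatFunc ℚ)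
      (Tfun (fun I => hookPoly (partSum lam I)) H)
      ((RatFunc.X - 1) ^ (H.card - 1)) := by
  obtain ⟨L, hL⟩ := exists_forall_toFun_eq_zero lam
  have hne : H.Nonempty := Finset.card_pos.1 (by omega)
  have hhook : ∀ G, hookPoly (partSum lam G) = _ := fun G =>
    (partSum lam G).hookPoly_eq (L := L) (Finset.sum_eq_zero fun m _ => hL m)
  refine IsOneModPow.isOAt_sub_one ?_
  simp only [hhook, ← Finset.prod_zpow]
  rw [Finset.prod_comm]
  refine IsOneModPow.prod fun i _ => ?_
  rw [Finset.prod_comm]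
  refine IsOneModPow.prod fun k hk => ?_
  have hik := (Finset.mem_Ico.1 hk).1
  have hc := ratFunc_X_pow_ne_one (Nat.succ_ne_zero (k - i))
  simp only [partSum_sub lam _ hik, partSum_sub lam _ (Nat.le_succ_of_le hik), div_zpow,
    Finset.prod_div_distrib]
  have h1 := isOneModPow_altProd_qShifted
    (fun m => (lam m).toFun i - (lam m).toFun (k + 1)) hne hc 0
  have h2 := isOneModPow_altProd_qShifted
    (fun m => (lam m).toFun i - (lam m).toFun k) hne hc 0
  simp only [altProd, zero_add] at h1 h2
  exact h1.div h2
end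

section
/- Let r > j ≥ 1 and N ≥ 1 be integers and let λ^1,…,λ^r be partitions. For a partition λ define the polynomial b_j^N(λ) = Σ_{i=1}^{N} binom(λ_i, j)·t^{N−i} in ℤ[t], where binom(·, j) is the binomial coefficient and λ_i denotes the i-th part of λ (zero for i beyond the length of λ). Then Σ_{I ⊆ [r]} (−1)^{r−|I|}·b_j^N(λ^I) = 0 in ℤ[t], where λ^I = ⊕_{i∈I} λ^i and the sum runs over all subsets I of [r] including the empty set (with λ^∅ the zero partition). -/
/-- The polynomial `b_j^N(λ) = Σ_{i=1}^{N} binom(λ_i, j)·t^{N−i}` in `ℤ[t]`. -/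
noncomputable def bPoly (N j : ℕ) (lam : PartitionFun) : Polynomial ℤ :=
  ∑ i ∈ Finset.range N,
    Polynomial.C (((lam.toFun i).choose j : ℤ)) * Polynomial.X ^ (N - 1 - i)

/-- Inclusion-exclusion annihilates `n ↦ n.choose j` on sums of more than `j` naturals: it is the
`j`-th coefficient of `∏ k ∈ s, ((1 + X) ^ a k - 1)`, which is divisible by `X ^ #s`. -/
theorem sum_powerset_neg_one_pow_mul_choose_sum_eq_zero {ι : Type*} (s : Finset ι) (a : ι → ℕ)
    {j : ℕ} (hj : j < s.card) :
    ∑ I ∈ s.powerset, (-1 : ℤ) ^ (s.card - I.card) * ((∑ k ∈ I, a k).choose j : ℤ) = 0 := by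
  classical
  have hdvd : (Polynomial.X : Polynomial ℤ) ^ s.card ∣
      ∏ k ∈ s, ((1 + Polynomial.X) ^ a k + -1) := by
    rw [← Finset.prod_const]
    refine Finset.prod_dvd_prod_of_dvd _ _ fun k _ => ?_
    have h := sub_dvd_pow_sub_pow (1 + Polynomial.X : Polynomial ℤ) 1 (a k)
    rwa [one_pow, add_sub_cancel_left, sub_eq_add_neg] at h
  have hcoeff := Polynomial.X_pow_dvd_iff.mp hdvd j hj
  rw [Finset.prod_add, Polynomial.finsetSum_coeff] at hcoeff
  rw [← hcoeff]
  refine Finset.sum_congr rfl fun I hI => ?_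
  have hC : (-1 : Polynomial ℤ) ^ (s.card - I.card) =
      Polynomial.C ((-1 : ℤ) ^ (s.card - I.card)) := by simp
  rw [Finset.prod_const, Finset.card_sdiff_of_subset (Finset.mem_powerset.mp hI),
    Finset.prod_pow_eq_pow_sum, hC, Polynomial.coeff_mul_C, Polynomial.coeff_one_add_X_pow,
    mul_comm]

/-- for `r > j ≥ 1`, `N ≥ 1` and partitions `λ^1,…,λ^r`,
`Σ_{I ⊆ [r]} (−1)^{r−|I|}·b_j^N(λ^I) = 0` in `ℤ[t]`. -/
theorem alternating_sum_bPoly_vanishes (r j N : ℕ) (hj : 1 ≤ j) (hjr : j < r)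
    (hN : 1 ≤ N) (lam : Fin r → PartitionFun) :
    ∑ I ∈ (Finset.univ : Finset (Fin r)).powerset,
      ((-1 : ℤ) ^ (r - I.card)) • bPoly N j (partSum lam I) = 0 := by
  simp only [bPoly, Finset.smul_sum]
  rw [Finset.sum_comm]
  refine Finset.sum_eq_zero fun i _ => ?_
  have h := sum_powerset_neg_one_pow_mul_choose_sum_eq_zero Finset.univ
    (fun k => (lam k).toFun i) (j := j) (by simpa using hjr)
  rw [Finset.card_fin] at h
  simp only [← smul_mul_assoc, Polynomial.smul_C, smul_eq_mul]
  rw [← Finset.sum_mul, ← map_sum]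
  simp only [partSum]
  rw [h, map_zero, zero_mul]
end
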